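/- arXiv:2411.10653 — 8 statements merged into one kernel-verified Lean document; each statement's English description precedes it below -/
import Mathlib

section
/- Let F = C_1 ∧ … ∧ C_m be a 3-CNF formula over n Boolean variables, and let S be the indeterminate string over {0,1,$} constructed from F as described. Then S has a unique substring of length at most n if and only if F is satisfiable. -/
/-- A 3-clause over Boolean variables `x_0, …, x_{n-1}`: it consists of three
literals on three distinct variables `a < b < c`; the Booleans `na`, `nb`, `nc`
record whether the respective literal is negated (so, in the paper's notation,
`v_a = na`, `v_b = nb`, `v_c = nc`, reading the bit `0` as `false` and `1` as `true`). -/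
structure Clause3 (n : ℕ) where
  a : Fin n
  b : Fin n
  c : Fin n
  hab : a < b
  hbc : b < c
  na : Bool
  nb : Bool
  nc : Bool

/-- The clause `C` is satisfied by the assignment `σ`:
some literal of `C` evaluates to true. -/
def Clause3.Sat {n : ℕ} (C : Clause3 n) (σ : Fin n → Bool) : Prop :=
  σ C.a ≠ C.na ∨ σ C.b ≠ C.nb ∨ σ C.c ≠ C.nc

/-- The language of an indeterminate string `S` (a list of nonempty sets of
characters): all classic strings of the same length as `S` choosing, at each
position, a character of the corresponding symbol. -/
def Lang {α : Type*} (S : List (Set α)) : Set (List α) :=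
  {X | List.Forall₂ (fun x A => x ∈ A) X S}

/-- The classic string `P` occurs in the indeterminate string `S` at
(0-based) position `i`: some `X ∈ L(S)` has `P` as the substring of
length `|P|` starting at position `i`. -/
def OccursAt {α : Type*} (S : List (Set α)) (P : List α) (i : ℕ) : Prop :=
  ∃ X ∈ Lang S, (X.drop i).take P.length = P

/-- We model the alphabet `{0, 1, $}` as `Option Bool`:
`some false` is `0`, `some true` is `1`, and `none` is `$`. -/
abbrev OB := Option Bool

/-- The symbol `{0, 1}`. -/
def bitSym : Set OB := {some false, some true}

/-- The symbol `{$}`. -/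
def dolSym : Set OB := {none}

/-- The symbol `{0, 1, $}`. -/
def triSym : Set OB := {some false, some true, none}

/-- The indeterminate string `T_j` (over `{0,1}`, here embedded into `{0,1,$}`)
built from the clause `C = C_j`: position `a` carries `{v_a}`, position `b`
carries `{v_b}`, position `c` carries `{v_c}`, every other position carries `{0,1}`. -/
def clauseStr (n : ℕ) (C : Clause3 n) : List (Set OB) :=
  (List.finRange n).map fun i =>
    if i = C.a then {some C.na}
    else if i = C.b then {some C.nb}
    else if i = C.c then {some C.nc}
    else bitSym

/-- The indeterminate string
`S = T_1 · {$} · … · {$} · T_m · {$} · {0,1}^n · {$} · {0,1}^{n-1} · {$} · {0,1}^{n-1}`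
of the MUS reduction. -/
def musS (n : ℕ) (F : List (Clause3 n)) : List (Set OB) :=
  (F.map fun C => clauseStr n C ++ [dolSym]).flatten ++
    List.replicate n bitSym ++ [dolSym] ++
    List.replicate (n - 1) bitSym ++ [dolSym] ++
    List.replicate (n - 1) bitSym

/-- The indeterminate string
`S' = T_1 · {$} · … · {$} · T_m · {$} · {0,1,$}^{n-1} · {$} · {0,1}^{n-1}`
of the MAW (absent word) reduction. -/
def mawS (n : ℕ) (F : List (Clause3 n)) : List (Set OB) :=
  (F.map fun C => clauseStr n C ++ [dolSym]).flatten ++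
    List.replicate (n - 1) triSym ++ [dolSym] ++
    List.replicate (n - 1) bitSym

/-- The bitstring (over `{0,1} ⊆ {0,1,$}`) of length `n` encoding the
assignment `σ`: its `i`-th character is `1` iff `σ i` is true. -/
def bits {n : ℕ} (σ : Fin n → Bool) : List OB :=
  List.ofFn fun i => some (σ i)

def OccX {α : Type*} (S : List (Set α)) (P : List α) (i : ℕ) : Prop :=
  ∀ (k : ℕ) (x : α), P[k]? = some x → ∃ s, S[i + k]? = some s ∧ x ∈ s

theorem lang_exists {α : Type*} (S : List (Set α)) (hS : ∀ s ∈ S, s.Nonempty) (P : List α) :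
    ∀ i, OccX S P i → OccursAt S P i := by
  induction S generalizing P with
  | nil =>
    intro i h
    have : P = [] := by
      cases P with
      | nil => rfl
      | cons a t => obtain ⟨s, hs, _⟩ := h 0 a (by simp); simp at hs
    subst this
    exact ⟨[], List.Forall₂.nil, by simp⟩
  | cons s S ih =>
    have hS' : ∀ s ∈ S, s.Nonempty := fun t ht => hS t (by simp [ht])
    obtain ⟨y, hy⟩ := hS s (by simp)
    intro i h
    cases i with
    | succ i =>
      have h' : OccX S P i := by
        intro k x hk
        obtain ⟨t, ht, hx⟩ := h k x hk
        refine ⟨t, ?_, hx⟩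
        rw [show i + 1 + k = (i + k) + 1 by omega] at ht
        simpa using ht
      obtain ⟨X, hX, hP⟩ := ih hS' P i h'
      exact ⟨y :: X, List.Forall₂.cons hy hX, by simpa using hP⟩
    | zero =>
      cases P with
      | nil =>
        obtain ⟨X, hX, hP⟩ := ih hS' [] 0 (by intro k x hk; simp at hk)
        exact ⟨y :: X, List.Forall₂.cons hy hX, by simp⟩
      | cons p P =>
        have h' : OccX S P 0 := by
          intro k x hk
          obtain ⟨t, ht, hx⟩ := h (k + 1) x (by simpa using hk)
          refine ⟨t, ?_, hx⟩
          rw [show 0 + (k + 1) = (0 + k) + 1 by omega] at ht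
          simpa using ht
        obtain ⟨X, hX, hP⟩ := ih hS' P 0 h'
        obtain ⟨t, ht, hx⟩ := h 0 p (by simp)
        simp at ht
        subst ht
        exact ⟨p :: X, List.Forall₂.cons hx hX, by simpa using hP⟩

theorem occ_iff {α : Type*} (S : List (Set α)) (hS : ∀ s ∈ S, s.Nonempty) (P : List α) (i : ℕ) :
    OccursAt S P i ↔ OccX S P i := by
  refine ⟨?_, lang_exists S hS P i⟩
  rintro ⟨X, hX, hP⟩ k x hk
  have hX' : List.Forall₂ (fun x A => x ∈ A) X S := hX
  rw [List.forall₂_iff_get] at hX'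
  obtain ⟨hl, hX'⟩ := hX'
  rw [← hP, List.getElem?_take] at hk
  split at hk
  · rw [List.getElem?_drop, List.getElem?_eq_some_iff] at hk
    obtain ⟨h1, h2⟩ := hk
    refine ⟨S[i + k]'(hl ▸ h1), List.getElem?_eq_getElem _, ?_⟩
    have := hX' (i + k) h1 (hl ▸ h1)
    simp only [List.get_eq_getElem] at this
    rwa [h2] at this
  · simp at hk

theorem musS_cons (n : ℕ) (C : Clause3 n) (F : List (Clause3 n)) :
    musS n (C :: F) = clauseStr n C ++ dolSym :: musS n F := by
  simp [musS]

theorem clauseStr_length (n : ℕ) (C : Clause3 n) : (clauseStr n C).length = n := by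
  simp [clauseStr]

theorem clauseStr_getElem? (n : ℕ) (C : Clause3 n) (k : ℕ) (h : k < n) :
    (clauseStr n C)[k]? = some (if (⟨k, h⟩ : Fin n) = C.a then {some C.na}
    else if (⟨k, h⟩ : Fin n) = C.b then {some C.nb}
    else if (⟨k, h⟩ : Fin n) = C.c then {some C.nc}
    else bitSym) := by
  simp [clauseStr, h]

theorem clauseStr_none (n : ℕ) (C : Clause3 n) (k : ℕ) (s : Set OB)
    (h : (clauseStr n C)[k]? = some s) : none ∉ s ∧ s.Nonempty := by
  have hk : k < n := by
    by_contra hk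
    rw [List.getElem?_eq_none (by rw [clauseStr_length]; omega)] at h
    simp at h
  rw [clauseStr_getElem? n C k hk] at h
  simp only [Option.some.injEq] at h
  subst h
  split_ifs <;> simp [bitSym]

theorem musS_nil (n : ℕ) (hn : 0 < n) (k : ℕ) :
    (musS n [])[k]? = if k < 3 * n then
      (if k = n ∨ k = 2 * n then some dolSym else some bitSym) else none := by
  simp only [musS, List.map_nil, List.flatten_nil, List.nil_append, List.getElem?_append,
    List.length_append, List.length_replicate, List.length_singleton, List.getElem?_replicate]
  split_ifs <;> first | rfl | omega | skip
  all_goals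
    first
    | (rw [show k - n = 0 by omega]; rfl)
    | (rw [show k - (n + 1 + (n - 1)) = 0 by omega]; rfl)
    | skip

theorem musS_left (n : ℕ) (C : Clause3 n) (F : List (Clause3 n)) (k : ℕ) (hk : k < n) :
    (musS n (C :: F))[k]? = (clauseStr n C)[k]? := by
  rw [musS_cons, List.getElem?_append_left (by rwa [clauseStr_length])]

theorem musS_mid (n : ℕ) (C : Clause3 n) (F : List (Clause3 n)) :
    (musS n (C :: F))[n]? = some dolSym := by
  rw [musS_cons, List.getElem?_append_right (by rw [clauseStr_length]), clauseStr_length]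
  simp

theorem musS_right (n : ℕ) (C : Clause3 n) (F : List (Clause3 n)) (k : ℕ) :
    (musS n (C :: F))[n + 1 + k]? = (musS n F)[k]? := by
  rw [musS_cons, List.getElem?_append_right (by rw [clauseStr_length]; omega), clauseStr_length,
    show n + 1 + k - n = k + 1 by omega]
  simp

theorem musS_nonempty (n : ℕ) (F : List (Clause3 n)) : ∀ s ∈ musS n F, s.Nonempty := by
  induction F with
  | nil =>
    intro s hs
    simp only [musS, List.map_nil, List.flatten_nil, List.nil_append, List.mem_append,
      List.mem_replicate, List.mem_singleton] at hs
    have h1 : bitSym.Nonempty := by simp [bitSym]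
    have h2 : dolSym.Nonempty := by simp [dolSym]
    rcases hs with (((h | h) | h) | h) | h
    · exact h.2 ▸ h1
    · exact h ▸ h2
    · exact h.2 ▸ h1
    · exact h ▸ h2
    · exact h.2 ▸ h1
  | cons C F ih =>
    intro s hs
    rw [musS_cons, List.mem_append, List.mem_cons] at hs
    rcases hs with h | h | h
    · obtain ⟨k, hk⟩ := List.getElem?_of_mem h
      exact (clauseStr_none n C k s hk).2
    · subst h; simp [dolSym]
    · exact ih s h

theorem occ_shift (n : ℕ) (C : Clause3 n) (F : List (Clause3 n)) (P : List OB) (i : ℕ) :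
    OccX (musS n (C :: F)) P (n + 1 + i) ↔ OccX (musS n F) P i := by
  simp only [OccX, add_assoc (n + 1), musS_right]

theorem occ_base (n : ℕ) (F : List (Clause3 n)) (P : List OB) (i : ℕ)
    (h : OccX (musS n []) P i) : OccX (musS n F) P (F.length * (n + 1) + i) := by
  induction F with
  | nil => simpa using h
  | cons C F ih =>
    rw [← occ_shift n C] at ih
    convert ih using 1
    simp only [List.length_cons]; ring

theorem bitSym_none : (none : OB) ∉ bitSym := by simp [bitSym]
theorem bitSym_some (b : Bool) : (some b : OB) ∈ bitSym := by cases b <;> simp [bitSym]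

theorem dol_ge (n : ℕ) (hn : 0 < n) (F : List (Clause3 n)) (p : ℕ) (s : Set OB)
    (h : (musS n F)[p]? = some s) (hs : none ∈ s) : n ≤ p := by
  by_contra hp
  cases F with
  | nil =>
    rw [musS_nil n hn, if_pos (by omega), if_neg (by omega)] at h
    simp only [Option.some.injEq] at h
    subst h; exact bitSym_none hs
  | cons C F =>
    rw [musS_left n C F p (by omega)] at h
    exact (clauseStr_none n C p s h).1 hs

theorem dol_dist (n : ℕ) (hn : 0 < n) (F : List (Clause3 n)) (p q : ℕ) (s t : Set OB)
    (h : (musS n F)[p]? = some s) (hs : none ∈ s)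
    (h' : (musS n F)[q]? = some t) (ht : none ∈ t) (hpq : p < q) : p + n ≤ q := by
  have h1 := dol_ge n hn F p s h hs
  induction F generalizing p q with
  | nil =>
    rw [musS_nil n hn] at h h'
    have a : p = n ∨ p = 2 * n := by
      by_contra hc
      rw [if_neg hc] at h
      split_ifs at h
      simp only [Option.some.injEq] at h
      subst h; exact bitSym_none hs
    have b : q = n ∨ q = 2 * n := by
      by_contra hc
      rw [if_neg hc] at h'
      split_ifs at h'
      simp only [Option.some.injEq] at h'
      subst h'; exact bitSym_none ht
    omega
  | cons C F ih =>
    obtain ⟨q, rfl⟩ : ∃ r, q = n + 1 + r := ⟨q - (n + 1), by omega⟩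
    rw [musS_right] at h'
    have h2 := dol_ge n hn F q t h' ht
    rcases Nat.lt_or_ge n p with hp | hp
    · obtain ⟨p, rfl⟩ : ∃ r, p = n + 1 + r := ⟨p - (n + 1), by omega⟩
      rw [musS_right] at h
      have := ih p q h h' (by omega) (dol_ge n hn F p s h hs)
      omega
    · omega

theorem bits_get {n : ℕ} (σ : Fin n → Bool) (k : ℕ) (h : k < n) :
    (bits σ)[k]? = some (some (σ ⟨k, h⟩)) := by
  simp [bits, h]

theorem bits_lt {n : ℕ} (σ : Fin n → Bool) (k : ℕ) (x : OB) (h : (bits σ)[k]? = some x) :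
    k < n := by
  by_contra hk
  rw [List.getElem?_eq_none (by simp [bits]; omega)] at h
  simp at h

theorem occ_clause {n : ℕ} (C : Clause3 n) (σ : Fin n → Bool) :
    OccX (clauseStr n C) (bits σ) 0 ↔ ¬ C.Sat σ := by
  have hab := C.hab
  have hbc := C.hbc
  constructor
  · intro h hsat
    have key : ∀ k : Fin n, some (σ k) ∈ (if k = C.a then ({some C.na} : Set OB)
        else if k = C.b then {some C.nb}
        else if k = C.c then {some C.nc}
        else bitSym) := by
      intro k
      obtain ⟨s, hs, hx⟩ := h k _ (bits_get σ k k.2)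
      rw [zero_add, clauseStr_getElem? n C k k.2] at hs
      simp only [Option.some.injEq] at hs
      subst hs
      exact hx
    rcases hsat with h | h | h
    · have := key C.a
      simp at this
      exact h this
    · have := key C.b
      rw [if_neg hab.ne'] at this
      simp at this
      exact h this
    · have := key C.c
      rw [if_neg (hab.trans hbc).ne', if_neg hbc.ne'] at this
      simp at this
      exact h this
  · intro hs k x hk
    have hkn := bits_lt σ k x hk
    rw [bits_get σ k hkn] at hk
    simp only [Option.some.injEq] at hk
    subst hk
    rw [zero_add, clauseStr_getElem? n C k hkn]
    refine ⟨_, rfl, ?_⟩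
    simp only [Clause3.Sat, not_or, not_not] at hs
    split_ifs with h1 h2 h3
    · rw [h1, hs.1]; rfl
    · rw [h2, hs.2.1]; rfl
    · rw [h3, hs.2.2]; rfl
    · exact bitSym_some _

theorem occ_of_clause {n : ℕ} (F : List (Clause3 n)) (C : Clause3 n) (hC : C ∈ F)
    (σ : Fin n → Bool) (h : OccX (clauseStr n C) (bits σ) 0) :
    ∃ i < F.length * (n + 1), OccX (musS n F) (bits σ) i := by
  induction F with
  | nil => simp at hC
  | cons D F ih =>
    rcases List.mem_cons.1 hC with rfl | hC
    · refine ⟨0, by simp, ?_⟩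
      intro k x hk
      have := bits_lt σ k x hk
      rw [musS_left _ _ _ _ (by omega)]
      exact h k x hk
    · obtain ⟨i, hi, ho⟩ := ih hC
      refine ⟨n + 1 + i, ?_, (occ_shift n D F _ i).2 ho⟩
      simp only [List.length_cons]
      nlinarith

theorem occ_unique {n : ℕ} (hn : 0 < n) (F : List (Clause3 n)) (σ : Fin n → Bool)
    (hF : ∀ C ∈ F, C.Sat σ) (i : ℕ) (h : OccX (musS n F) (bits σ) i) :
    i = F.length * (n + 1) := by
  have nodol : ∀ (F : List (Clause3 n)) (i k : ℕ), OccX (musS n F) (bits σ) i → k < n →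
      (musS n F)[i + k]? ≠ some dolSym := by
    intro F i k h hk hc
    obtain ⟨s, hs, hx⟩ := h k _ (bits_get σ k hk)
    rw [hc] at hs
    simp only [Option.some.injEq] at hs
    subst hs
    simp [dolSym] at hx
  induction F generalizing i with
  | nil =>
    obtain ⟨s, hs, hx⟩ := h (n - 1) _ (bits_get σ (n - 1) (by omega))
    rw [musS_nil n hn] at hs
    have hlt : i + (n - 1) < 3 * n := by
      by_contra hc
      rw [if_neg hc] at hs
      simp at hs
    simp only [List.length_nil, zero_mul]
    by_contra hi
    rcases Nat.lt_or_ge n i with h1 | h1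
    · refine nodol [] i (2 * n - i) h (by omega) ?_
      rw [musS_nil n hn, if_pos (by omega), if_pos (by omega)]
    · refine nodol [] i (n - i) h (by omega) ?_
      rw [musS_nil n hn, if_pos (by omega), if_pos (by omega)]
  | cons C F ih =>
    rcases Nat.lt_or_ge n i with h1 | h1
    · obtain ⟨i, rfl⟩ : ∃ r, i = n + 1 + r := ⟨i - (n + 1), by omega⟩
      rw [occ_shift] at h
      have := ih (fun D hD => hF D (by simp [hD])) i h
      rw [this, List.length_cons]; ring
    · exfalso
      rcases Nat.eq_zero_or_pos i with rfl | h0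
      · refine (occ_clause C σ).1 ?_ (hF C (by simp))
        intro k x hk
        have := bits_lt σ k x hk
        obtain ⟨s, hs, hx⟩ := h k x hk
        rw [musS_left _ _ _ _ (by omega)] at hs
        exact ⟨s, hs, hx⟩
      · refine nodol (C :: F) i (n - i) h (by omega) ?_
        rw [show i + (n - i) = n by omega, musS_mid]

theorem occ_bits {n : ℕ} (hn : 0 < n) (P : List OB) (i : ℕ) (hP : none ∉ P)
    (h : ∀ k < P.length, i + k < 3 * n ∧ i + k ≠ n ∧ i + k ≠ 2 * n) :
    OccX (musS n []) P i := by
  intro k x hk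
  obtain ⟨hk', hx⟩ := List.getElem?_eq_some_iff.1 hk
  have := h k hk'
  rw [musS_nil n hn, if_pos (by omega), if_neg (by omega)]
  refine ⟨_, rfl, ?_⟩
  cases x with
  | none => exact absurd (List.mem_of_getElem? hk) hP
  | some b => exact bitSym_some b

/-- `S` has a unique substring of length at most `n`
iff the 3-CNF `F` is satisfiable. -/
theorem unique_substring_iff_satisfiable (n : ℕ) (hn : 0 < n) (F : List (Clause3 n)) :
    (∃ P : List OB, P.length ≤ n ∧ ∃! i : ℕ, OccursAt (musS n F) P i) ↔
      ∃ σ : Fin n → Bool, ∀ C ∈ F, C.Sat σ := by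
  simp only [occ_iff _ (musS_nonempty n F)]
  constructor
  · rintro ⟨P, hP, i, hi, hu⟩
    have two : ∀ a b, OccX (musS n []) P a → OccX (musS n []) P b → a = b := by
      intro a b ha hb
      have h1 := hu _ (occ_base n F P a ha)
      have h2 := hu _ (occ_base n F P b hb)
      omega
    by_cases hd : none ∈ P
    · exfalso
      obtain ⟨q, hq⟩ := List.getElem?_of_mem hd
      obtain ⟨hq', -⟩ := List.getElem?_eq_some_iff.1 hq
      have ho : ∀ k, k ≠ q → P[k]? ≠ some none := by
        intro k hkq hk
        obtain ⟨hk', -⟩ := List.getElem?_eq_some_iff.1 hk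
        obtain ⟨s, hs, hx⟩ := hi q _ hq
        obtain ⟨t, ht, hy⟩ := hi k _ hk
        rcases Nat.lt_or_gt_of_ne hkq with h | h
        · have := dol_dist n hn F _ _ _ _ ht hy hs hx (by omega)
          omega
        · have := dol_dist n hn F _ _ _ _ hs hx ht hy (by omega)
          omega
      have hocc : ∀ c, c = n ∨ c = 2 * n → OccX (musS n []) P (c - q) := by
        intro c hc k x hk
        obtain ⟨hk', -⟩ := List.getElem?_eq_some_iff.1 hk
        rw [musS_nil n hn]
        by_cases hkq : k = q
        · subst hkq
          rw [hq] at hk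
          simp only [Option.some.injEq] at hk
          subst hk
          rw [if_pos (by omega), if_pos (by omega)]
          exact ⟨_, rfl, rfl⟩
        · rw [if_pos (by omega), if_neg (by omega)]
          refine ⟨_, rfl, ?_⟩
          cases x with
          | none => exact absurd hk (ho k hkq)
          | some b => exact bitSym_some b
      have := two _ _ (hocc n (Or.inl rfl)) (hocc (2 * n) (Or.inr rfl))
      omega
    · rcases Nat.lt_or_ge P.length n with hl | hl
      · exfalso
        have := two (n + 1) (2 * n + 1)
          (occ_bits hn P _ hd (by intro k hk; omega)) (occ_bits hn P _ hd (by intro k hk; omega))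
        omega
      · have hl' : P.length = n := le_antisymm hP hl
        have hb : ∃ σ : Fin n → Bool, P = bits σ := by
          have : ∀ k : Fin n, ∃ b : Bool, P[(k : ℕ)]? = some (some b) := by
            intro k
            have hk : (k : ℕ) < P.length := by have := k.2; omega
            rcases hx : P[(k : ℕ)] with _ | b
            · exact absurd (hx ▸ List.getElem_mem hk) hd
            · exact ⟨b, by rw [List.getElem?_eq_getElem hk, hx]⟩
          choose σ hσ using this
          refine ⟨σ, List.ext_getElem? fun k => ?_⟩
          by_cases hk : k < n
          · rw [bits_get σ k hk]; exact hσ ⟨k, hk⟩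
          · rw [List.getElem?_eq_none (by omega), List.getElem?_eq_none (by simp [bits]; omega)]
        obtain ⟨σ, rfl⟩ := hb
        refine ⟨σ, fun C hC => ?_⟩
        by_contra hs
        obtain ⟨j, hj, ho⟩ := occ_of_clause F C hC σ ((occ_clause C σ).2 hs)
        have h1 := hu _ ho
        have h2 := hu _ (occ_base n F _ 0 (occ_bits hn _ _ hd (by intro k hk; omega)))
        omega
  · rintro ⟨σ, hσ⟩
    have hlen : (bits σ).length = n := by simp [bits]
    refine ⟨bits σ, hlen.le, F.length * (n + 1), ?_, fun i hi => occ_unique hn F σ hσ i hi⟩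
    exact occ_base n F _ 0 (occ_bits hn _ _ (by simp [bits]) (by intro k hk; omega))
end

section
/- Let F be a 3-CNF formula over n Boolean variables and S the indeterminate string over {0,1,$} constructed from F as described. Then S has no unique substring of length strictly less than n, and every unique substring of S of length exactly n contains no occurrence of the character $ (i.e., it is a bitstring in {0,1}^n). -/
def HasDol (S : List (Set OB)) (i : ℕ) : Prop := ∃ A, S[i]? = some A ∧ (none : OB) ∈ A

def GoodS (n : ℕ) (S : List (Set OB)) : Prop :=
  (∀ i, HasDol S i → n ≤ i + 1) ∧ (∀ i j, i < j → HasDol S i → HasDol S j → n ≤ j - i)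

lemma good_block (n : ℕ) (B S : List (Set OB)) (hB : ∀ A ∈ B, (none : OB) ∉ A)
    (hl : n ≤ B.length + 1) (hS : GoodS n S) : GoodS n (B ++ [dolSym] ++ S) := by
  have key : ∀ i, HasDol (B ++ [dolSym] ++ S) i →
      i = B.length ∨ ∃ k, i = B.length + 1 + k ∧ HasDol S k := by
    rintro i ⟨A, hA, hn⟩
    rcases lt_trichotomy i B.length with h | h | h
    · exfalso
      rw [List.append_assoc, List.getElem?_append_left h] at hA
      exact hB A (List.mem_of_getElem? hA) hn
    · exact Or.inl h
    · right
      refine ⟨i - (B.length + 1), by omega, A, ?_, hn⟩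
      rw [List.getElem?_append_right (by simp; omega)] at hA
      simpa using hA
  constructor
  · intro i hi
    rcases key i hi with h | ⟨k, h, _⟩ <;> omega
  · intro i j hij hi hj
    rcases key i hi with h | ⟨k, h, hk⟩ <;> rcases key j hj with h' | ⟨k', h', hk'⟩
    · omega
    · have := hS.1 k' hk'; omega
    · omega
    · have := hS.2 k k' (by omega) hk hk'; omega

lemma rep_nodol (k : ℕ) : ∀ A ∈ List.replicate k bitSym, (none : OB) ∉ A := by
  intro A hA
  rw [List.eq_of_mem_replicate hA]
  simp [bitSym]

lemma clause_nodol (n : ℕ) (C : Clause3 n) : ∀ A ∈ clauseStr n C, (none : OB) ∉ A := by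
  intro A hA
  simp only [clauseStr, List.mem_map] at hA
  obtain ⟨i, _, rfl⟩ := hA
  split_ifs <;> simp [bitSym]

lemma good_mus (n : ℕ) (F : List (Clause3 n)) : GoodS n (musS n F) := by
  induction F with
  | nil =>
    have h0 : GoodS n (List.replicate (n-1) bitSym) := by
      have : ∀ i, ¬ HasDol (List.replicate (n-1) bitSym) i := by
        rintro i ⟨A, hA, hn⟩
        exact rep_nodol _ A (List.mem_of_getElem? hA) hn
      exact ⟨fun i hi => absurd hi (this i), fun i j _ hi => absurd hi (this i)⟩
    have h1 := good_block n (List.replicate (n-1) bitSym) _ (rep_nodol _) (by simp; omega) h0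
    have h2 := good_block n (List.replicate n bitSym) _ (rep_nodol _) (by simp) h1
    simpa [musS] using h2
  | cons C F ih =>
    have h2 := good_block n (clauseStr n C) _ (clause_nodol _ _) (by simp [clauseStr]) ih
    simpa [musS] using h2

lemma lang_append {A B : List (Set OB)} {x y : List OB} (hx : x ∈ Lang A) (hy : y ∈ Lang B) :
    x ++ y ∈ Lang (A ++ B) := List.rel_append hx hy

lemma lang_nonempty (S : List (Set OB)) (h : ∀ A ∈ S, A.Nonempty) : ∃ x, x ∈ Lang S := by
  induction S with
  | nil => exact ⟨[], List.Forall₂.nil⟩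
  | cons A S ih =>
    obtain ⟨x, hx⟩ := ih (fun B hB => h B (List.mem_cons_of_mem _ hB))
    obtain ⟨a, ha⟩ := h A List.mem_cons_self
    exact ⟨a :: x, List.Forall₂.cons ha hx⟩

lemma mus_nonempty (n : ℕ) (F : List (Clause3 n)) : ∀ A ∈ musS n F, A.Nonempty := by
  have hb : bitSym.Nonempty := ⟨some false, by simp [bitSym]⟩
  have hd : dolSym.Nonempty := ⟨none, by simp [dolSym]⟩
  intro A hA
  simp only [musS, List.mem_append, List.mem_flatten, List.mem_map, List.mem_replicate,
    List.mem_singleton] at hA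
  rcases hA with ((((⟨l, ⟨C, _, rfl⟩, h⟩ | h) | h) | h) | h) | h
  · rcases List.mem_append.1 h with h | h
    · simp only [clauseStr, List.mem_map] at h
      obtain ⟨i, _, rfl⟩ := h
      split_ifs <;> simp [hb]
    · rw [List.mem_singleton.1 h]; exact hd
  · rw [h.2]; exact hb
  · rw [h]; exact hd
  · rw [h.2]; exact hb
  · rw [h]; exact hd
  · rw [h.2]; exact hb

lemma occ_of (A B C : List (Set OB)) (hne : ∀ s ∈ A ++ B ++ C, s.Nonempty) (P : List OB)
    (hP : P ∈ Lang B) : OccursAt (A ++ B ++ C) P A.length := by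
  obtain ⟨x, hx⟩ := lang_nonempty A (fun s hs => hne s (by simp [hs]))
  obtain ⟨y, hy⟩ := lang_nonempty C (fun s hs => hne s (by simp [hs]))
  refine ⟨x ++ P ++ y, lang_append (lang_append hx hP) hy, ?_⟩
  have : x.length = A.length := List.Forall₂.length_eq hx
  rw [← this]
  simp

lemma bits_lang (P : List OB) (h : none ∉ P) : P ∈ Lang (List.replicate P.length bitSym) := by
  induction P with
  | nil => exact List.Forall₂.nil
  | cons a P ih =>
    simp only [List.mem_cons, not_or] at h
    refine List.Forall₂.cons ?_ (ih h.2)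
    rcases a with _ | (_ | _)
    · exact absurd rfl h.1
    · simp [bitSym]
    · simp [bitSym]

lemma occ_bits_s1 (S pre post : List (Set OB)) (a : ℕ) (P : List OB)
    (hS : S = pre ++ List.replicate a bitSym ++ post)
    (hne : ∀ s ∈ S, s.Nonempty) (h : none ∉ P) (hl : P.length ≤ a) :
    OccursAt S P pre.length := by
  have e : S = pre ++ List.replicate P.length bitSym ++
      (List.replicate (a - P.length) bitSym ++ post) := by
    have : a = P.length + (a - P.length) := by omega
    rw [hS]
    conv_lhs => rw [this, List.replicate_add]
    simp only [List.append_assoc, List.cons_append, List.nil_append]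
  rw [e] at hne ⊢
  exact occ_of _ _ _ hne _ (bits_lang P h)

lemma occ_dol (S pre post : List (Set OB)) (a b : ℕ) (u v : List OB)
    (hS : S = pre ++ List.replicate a bitSym ++ [dolSym] ++ List.replicate b bitSym ++ post)
    (hne : ∀ s ∈ S, s.Nonempty) (hu : none ∉ u) (hv : none ∉ v)
    (ha : u.length ≤ a) (hb : v.length ≤ b) :
    OccursAt S (u ++ none :: v) (pre.length + (a - u.length)) := by
  have e : S = (pre ++ List.replicate (a - u.length) bitSym) ++
      (List.replicate u.length bitSym ++ dolSym :: List.replicate v.length bitSym) ++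
      (List.replicate (b - v.length) bitSym ++ post) := by
    have h1 : a = (a - u.length) + u.length := by omega
    have h2 : b = v.length + (b - v.length) := by omega
    rw [hS]
    conv_lhs => rw [h1, h2, List.replicate_add, List.replicate_add]
    simp only [List.append_assoc, List.cons_append, List.nil_append]
  rw [e] at hne ⊢
  have := occ_of _ _ _ hne (u ++ none :: v)
    (lang_append (bits_lang u hu) (List.Forall₂.cons (by simp [dolSym]) (bits_lang v hv)))
  simpa using this

lemma occ_hasDol (S : List (Set OB)) (P : List OB) (i k : ℕ) (h : OccursAt S P i)
    (hk : P[k]? = some none) : HasDol S (i + k) := by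
  obtain ⟨X, hX, hP⟩ := h
  rw [← hP] at hk
  have hX' : X[i + k]? = some none := by
    rw [List.getElem?_take] at hk
    split_ifs at hk
    simpa using hk
  obtain ⟨hlt, hg⟩ := List.getElem?_eq_some_iff.1 hX'
  have hlen : X.length = S.length := List.Forall₂.length_eq hX
  refine ⟨S[i+k]'(by omega), List.getElem?_eq_getElem _, ?_⟩
  have := List.Forall₂.get hX hlt (by omega)
  simpa [hg] using this

lemma not_unique_dol (n : ℕ) (F : List (Clause3 n)) (P : List OB) (hl : P.length ≤ n)
    (hP : none ∈ P) : ¬ ∃! i : ℕ, OccursAt (musS n F) P i := by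
  intro hex
  obtain ⟨i, hi, -⟩ := id hex
  obtain ⟨u, v, rfl, hu⟩ := List.eq_append_cons_of_mem hP
  simp only [List.length_append, List.length_cons] at hl
  have hv : none ∉ v := by
    intro hv
    obtain ⟨t, ht, hvt⟩ := List.mem_iff_getElem.1 hv
    have h1 := occ_hasDol _ _ i u.length hi (by simp)
    have h2 := occ_hasDol _ _ i (u.length + (t + 1)) hi (by simp [hvt, ht])
    have := (good_mus n F).2 _ _ (by omega) h1 h2
    omega
  have o1 := occ_dol (musS n F) (F.map fun C => clauseStr n C ++ [dolSym]).flatten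
    ([dolSym] ++ List.replicate (n - 1) bitSym) n (n-1) u v (by simp [musS])
    (mus_nonempty n F) hu hv (by omega) (by omega)
  have o2 := occ_dol (musS n F) ((F.map fun C => clauseStr n C ++ [dolSym]).flatten ++
    List.replicate n bitSym ++ [dolSym]) [] (n-1) (n-1) u v (by simp [musS])
    (mus_nonempty n F) hu hv (by omega) (by omega)
  have := hex.unique o1 o2
  simp only [List.length_append, List.length_replicate, List.length_singleton] at this
  omega

lemma not_unique_bits (n : ℕ) (F : List (Clause3 n)) (P : List OB) (hl : P.length < n)
    (hP : none ∉ P) : ¬ ∃! i : ℕ, OccursAt (musS n F) P i := by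
  intro hex
  have o1 := occ_bits_s1 (musS n F) (F.map fun C => clauseStr n C ++ [dolSym]).flatten
    ([dolSym] ++ List.replicate (n - 1) bitSym ++ [dolSym] ++ List.replicate (n - 1) bitSym)
    n P (by simp [musS]) (mus_nonempty n F) hP (by omega)
  have o2 := occ_bits_s1 (musS n F) ((F.map fun C => clauseStr n C ++ [dolSym]).flatten ++
    List.replicate n bitSym ++ [dolSym]) ([dolSym] ++ List.replicate (n - 1) bitSym)
    (n-1) P (by simp [musS]) (mus_nonempty n F) hP (by omega)
  have := hex.unique o1 o2
  simp only [List.length_append, List.length_replicate, List.length_singleton] at this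
  omega

/-- `S` has no unique substring of length strictly less than `n`,
and every unique substring of `S` of length exactly `n` contains no `$`
(i.e., it is a bitstring of length `n`). -/
theorem no_short_unique_substring_and_unique_is_bitstring
    (n : ℕ) (F : List (Clause3 n)) :
    (∀ P : List OB, P.length < n → ¬ ∃! i : ℕ, OccursAt (musS n F) P i) ∧
    (∀ P : List OB, P.length = n → (∃! i : ℕ, OccursAt (musS n F) P i) →
      (none : OB) ∉ P) := by
  refine ⟨fun P hl => ?_, fun P hl hex hP => not_unique_dol n F P hl.le hP hex⟩
  by_cases hP : none ∈ P
  · exact not_unique_dol n F P hl.le hP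
  · exact not_unique_bits n F P hl hP
end

section
/- Let C_j be a clause of a 3-CNF formula F over n Boolean variables and let T_j be the indeterminate string of length n constructed from C_j as described. Then for every bitstring B ∈ {0,1}^n, B belongs to the language L(T_j) if and only if the assignment encoded by B makes all three literals of C_j false (i.e., falsifies C_j). -/
/-- For every bitstring `B ∈ {0,1}^n` (encoded by the assignment
`σ` via `bits σ`, which ranges over exactly the bitstrings of length `n`):
`B` belongs to the language `L(T_j)` of the indeterminate string built from the
clause `C = C_j` iff the assignment encoded by `B` makes all three literals of
`C_j` false, i.e., falsifies `C_j`. -/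
theorem mem_clauseStr_iff_falsifies (n : ℕ) (C : Clause3 n) (σ : Fin n → Bool) :
    bits σ ∈ Lang (clauseStr n C) ↔ ¬ C.Sat σ := by
  have key : bits σ ∈ Lang (clauseStr n C) ↔ ∀ i : Fin n, (some (σ i) : OB) ∈
      (if i = C.a then ({some C.na} : Set OB)
        else if i = C.b then {some C.nb}
        else if i = C.c then {some C.nc}
        else bitSym) := by
    unfold bits Lang clauseStr
    rw [Set.mem_setOf_eq, List.ofFn_eq_map, List.forall₂_map_left_iff,
      List.forall₂_map_right_iff, List.forall₂_same]
    simp only [List.mem_finRange, true_imp_iff]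
  rw [key]
  have hab := C.hab
  have hbc := C.hbc
  have hba : C.b ≠ C.a := ne_of_gt hab
  have hcb : C.c ≠ C.b := ne_of_gt hbc
  have hca : C.c ≠ C.a := ne_of_gt (hab.trans hbc)
  unfold Clause3.Sat
  push Not
  constructor
  · intro h
    have h1 := h C.a
    have h2 := h C.b
    have h3 := h C.c
    simp [hba] at h1
    simp [hba] at h2
    simp [hca, hcb] at h3
    exact ⟨h1, h2, h3⟩
  · rintro ⟨h1, h2, h3⟩ i
    split_ifs with ha hb hc
    · subst ha; simp [h1]
    · subst hb; simp [h2]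
    · subst hc; simp [h3]
    · cases σ i <;> simp [bitSym]
end

section
/- Let F be a 3-CNF formula over n Boolean variables and S the indeterminate string over {0,1,$} constructed from F as described. If a bitstring B ∈ {0,1}^n encodes an assignment satisfying F, then B is a minimal unique substring (MUS) of S: B occurs at exactly one position of S, and every proper substring of B occurs at at least two positions of S. -/
theorem occ_pt {α : Type*} {S : List (Set α)} {P : List α} {i : ℕ} (h : OccursAt S P i)
    (k : ℕ) (hk : k < P.length) : ∃ A, S[i+k]? = some A ∧ P[k] ∈ A := by
  obtain ⟨X, hX, hP⟩ := h
  have hX' : List.Forall₂ (fun x A => x ∈ A) X S := hX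
  rw [List.forall₂_iff_get] at hX'
  obtain ⟨hl, hm⟩ := hX'
  have h1 : P[k]? = X[i+k]? := by
    conv_lhs => rw [← hP]
    rw [List.getElem?_take_of_lt hk, List.getElem?_drop]
  rw [List.getElem?_eq_getElem hk] at h1
  obtain ⟨h2, h3⟩ := List.getElem?_eq_some_iff.1 h1.symm
  refine ⟨S[i+k]'(hl ▸ h2), List.getElem?_eq_getElem _, ?_⟩
  have := hm (i+k) h2 (hl ▸ h2)
  simp only [List.get_eq_getElem] at this
  rwa [h3] at this

theorem exists_lang {α : Type*} (S : List (Set α)) (h : ∀ A ∈ S, A.Nonempty) :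
    ∃ X, List.Forall₂ (fun x A => x ∈ A) X S := by
  induction S with
  | nil => exact ⟨[], .nil⟩
  | cons A S ih =>
    obtain ⟨x, hx⟩ := h A (by simp)
    obtain ⟨X, hX⟩ := ih (fun B hB => h B (by simp [hB]))
    exact ⟨x :: X, .cons hx hX⟩

theorem occ_of_append {α : Type*} (A M C : List (Set α)) (P : List α)
    (hA : ∀ s ∈ A, s.Nonempty) (hC : ∀ s ∈ C, s.Nonempty)
    (hP : List.Forall₂ (fun x A => x ∈ A) P M) : OccursAt (A ++ M ++ C) P A.length := by
  obtain ⟨X, hX⟩ := exists_lang A hA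
  obtain ⟨Y, hY⟩ := exists_lang C hC
  refine ⟨X ++ P ++ Y, List.rel_append (List.rel_append hX hP) hY, ?_⟩
  rw [← hX.length_eq]
  simp

theorem forall2_rep (P : List OB) (h : ∀ x ∈ P, x ∈ bitSym) :
    List.Forall₂ (fun x A => x ∈ A) P (List.replicate P.length bitSym) := by
  induction P with
  | nil => exact .nil
  | cons x P ih =>
    exact .cons (h x (by simp)) (ih fun y hy => h y (by simp [hy]))

theorem some_mem_bit (b : Bool) : some b ∈ bitSym := by cases b <;> simp [bitSym]

theorem no_dol {n : ℕ} {S : List (Set OB)} {σ : Fin n → Bool} {i : ℕ}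
    (h : ∀ k : Fin n, ∃ A, S[i+k]? = some A ∧ some (σ k) ∈ A) (p : ℕ) (hp : S[p]? = some dolSym)
    (h1 : i ≤ p) (h2 : p < i + n) : False := by
  obtain ⟨A, hA, hm⟩ := h ⟨p - i, by omega⟩
  simp only [show i + (p - i) = p by omega, hp, Option.some.injEq] at hA
  subst hA
  simp [dolSym] at hm

theorem occ_uniq (n : ℕ) (hn : 0 < n) (F : List (Clause3 n)) (σ : Fin n → Bool)
    (hσ : ∀ C ∈ F, C.Sat σ) (i : ℕ)
    (h : ∀ k : Fin n, ∃ A, (musS n F)[i+k]? = some A ∧ some (σ k) ∈ A) :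
    i = F.length * (n+1) := by
  induction F generalizing i with
  | nil =>
    by_contra hi
    simp only [List.length_nil, zero_mul] at hi
    have hlen : (musS n []).length = 3 * n := by simp [musS]; omega
    have e1 : (musS n [])[n]? = some dolSym := by
      simp [musS]
    have e2 : (musS n [])[2*n]? = some dolSym := by
      simp only [musS]
      rw [List.getElem?_append_left (by simp; omega), List.getElem?_append_right (by simp; omega)]
      rw [List.getElem?_eq_some_iff]
      refine ⟨by simp; omega, by simp⟩
    by_cases c1 : i ≤ n
    · exact no_dol h n e1 c1 (by omega)
    by_cases c2 : i ≤ 2 * n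
    · exact no_dol h _ e2 c2 (by omega)
    obtain ⟨A, hA, _⟩ := h ⟨n-1, by omega⟩
    obtain ⟨h3, _⟩ := List.getElem?_eq_some_iff.1 hA
    simp only at h3
    omega
  | cons C F ih =>
    have hl : (clauseStr n C).length = n := by simp [clauseStr]
    rw [musS_cons] at h
    by_cases c0 : i = 0
    · exfalso
      subst c0
      have key : ∀ k : Fin n, some (σ k) ∈ (if k = C.a then {some C.na}
          else if k = C.b then {some C.nb}
          else if k = C.c then {some C.nc}
          else bitSym : Set OB) := by
        intro k
        obtain ⟨A, hA, hm⟩ := h k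
        rw [List.getElem?_append_left (by simp [hl])] at hA
        simp [clauseStr] at hA
        rw [hA]; exact hm
      have hab := C.hab
      have hbc := C.hbc
      have ka := key C.a
      have kb := key C.b
      have kc := key C.c
      rw [if_pos rfl] at ka
      rw [if_neg hab.ne', if_pos rfl] at kb
      rw [if_neg (hab.trans hbc).ne', if_neg hbc.ne', if_pos rfl] at kc
      simp at ka kb kc
      rcases hσ C (by simp) with h | h | h
      exacts [h ka, h kb, h kc]
    by_cases c1 : i ≤ n
    · exact (no_dol h n (by rw [List.getElem?_append_right (by omega)]; simp [hl]) c1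
        (by omega)).elim
    have := ih (fun D hD => hσ D (by simp [hD])) (i - (n+1)) (by
      intro k
      obtain ⟨A, hA, hm⟩ := h k
      refine ⟨A, ?_, hm⟩
      rw [List.getElem?_append_right (by omega), hl,
        show i + (k:ℕ) - n = (i - (n+1) + k) + 1 by omega, List.getElem?_cons_succ] at hA
      exact hA)
    simp only [List.length_cons, add_mul, one_mul]
    omega

/-- If the bitstring `B = bits σ ∈ {0,1}^n` encodes an assignment
`σ` satisfying `F`, then `B` is a minimal unique substring (MUS) of `S`:
`B` occurs at exactly one position of `S`, and every proper substring of `B`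
occurs at at least two positions of `S`. -/
theorem satisfying_bitstring_is_MUS
    (n : ℕ) (hn : 0 < n) (F : List (Clause3 n)) (σ : Fin n → Bool)
    (hσ : ∀ C ∈ F, C.Sat σ) :
    (∃! i : ℕ, OccursAt (musS n F) (bits σ) i) ∧
    (∀ Q : List OB, Q <:+: bits σ → Q ≠ bits σ →
      ∃ i j : ℕ, i ≠ j ∧ OccursAt (musS n F) Q i ∧ OccursAt (musS n F) Q j) := by
  have hlen : (bits σ).length = n := by simp [bits]
  have hbit : ∀ x ∈ bits σ, x ∈ bitSym := by
    intro x hx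
    simp only [bits, List.mem_ofFn] at hx
    obtain ⟨k, rfl⟩ := hx
    exact some_mem_bit _
  have hne := musS_nonempty n F
  constructor
  · apply existsUnique_of_exists_of_unique
    · refine ⟨((F.map fun C => clauseStr n C ++ [dolSym]).flatten).length, ?_⟩
      have e : musS n F = (F.map fun C => clauseStr n C ++ [dolSym]).flatten ++
          List.replicate (bits σ).length bitSym ++ ([dolSym] ++
          List.replicate (n - 1) bitSym ++ [dolSym] ++ List.replicate (n - 1) bitSym) := by
        simp [musS, hlen]
      rw [e] at hne ⊢
      exact occ_of_append _ _ _ _ (fun s hs => hne s (by simp only [List.mem_append]; tauto))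
        (fun s hs => hne s (List.mem_append_right _ hs)) (forall2_rep _ hbit)
    · have aux : ∀ i, OccursAt (musS n F) (bits σ) i → i = F.length * (n+1) := by
        intro i hi
        refine occ_uniq n hn F σ hσ i fun k => ?_
        obtain ⟨A, hA, hm⟩ := occ_pt hi k (by simp [hlen])
        exact ⟨A, hA, by simpa [bits] using hm⟩
      intro i j hi hj
      rw [aux i hi, aux j hj]
  · intro Q hQ hQne
    have hQl : Q.length < n := by
      have h1 := hQ.length_le
      rw [hlen] at h1
      refine lt_of_le_of_ne h1 fun h => hQne (hQ.eq_of_length (by rw [h, hlen]))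
    have hQb : ∀ x ∈ Q, x ∈ bitSym := fun x hx => hbit x (hQ.subset hx)
    have hr : List.replicate (n-1) bitSym =
        List.replicate Q.length bitSym ++ List.replicate (n-1-Q.length) bitSym := by
      rw [List.replicate_append_replicate]; congr 1; omega
    set A := (F.map fun C => clauseStr n C ++ [dolSym]).flatten ++
      List.replicate n bitSym ++ [dolSym] with hA
    have e1 : musS n F = A ++ List.replicate Q.length bitSym ++
        (List.replicate (n-1-Q.length) bitSym ++ [dolSym] ++ List.replicate (n-1) bitSym) := by
      have : musS n F = A ++ List.replicate (n-1) bitSym ++ ([dolSym] ++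
        List.replicate (n-1) bitSym) := by simp [musS, hA]
      rw [this]
      nth_rw 1 [hr]
      simp only [List.append_assoc]
    have e2 : musS n F = (A ++ List.replicate (n-1) bitSym ++ [dolSym]) ++
        List.replicate Q.length bitSym ++ List.replicate (n-1-Q.length) bitSym := by
      rw [List.append_assoc _ (List.replicate Q.length bitSym), ← hr]
      simp [musS, hA]
    refine ⟨A.length, (A ++ List.replicate (n-1) bitSym ++ [dolSym]).length, ?_, ?_, ?_⟩
    · simp only [List.length_append, List.length_singleton]; omega
    · rw [e1] at hne ⊢
      exact occ_of_append _ _ _ _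
        (fun s hs => hne s (List.mem_append_left _ (List.mem_append_left _ hs)))
        (fun s hs => hne s (List.mem_append_right _ hs)) (forall2_rep _ hQb)
    · rw [e2] at hne ⊢
      exact occ_of_append _ _ _ _
        (fun s hs => hne s (List.mem_append_left _ (List.mem_append_left _ hs)))
        (fun s hs => hne s (List.mem_append_right _ hs)) (forall2_rep _ hQb)
end

section
/- Let F be a 3-CNF formula over n Boolean variables and S' the indeterminate string over {0,1,$} constructed from F for the absent-word reduction as described. Then every string over {0,1,$} of length at most n−1 occurs in S'; consequently, every word absent from S' has length at least n. -/
theorem aux_lang_nonempty : ∀ (S : List (Set OB)), (∀ A ∈ S, A.Nonempty) →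
    ∃ X, List.Forall₂ (fun x A => x ∈ A) X S
  | [], _ => ⟨[], List.Forall₂.nil⟩
  | A :: S, h => by
    obtain ⟨x, hx⟩ := h A (by simp)
    obtain ⟨X, hX⟩ := aux_lang_nonempty S (fun B hB => h B (by simp [hB]))
    exact ⟨x :: X, List.Forall₂.cons hx hX⟩

theorem aux_tri (Q : List OB) :
    List.Forall₂ (fun x A => x ∈ A) Q (List.replicate Q.length triSym) := by
  induction Q with
  | nil => simp
  | cons x Q ih =>
    rw [List.length_cons, List.replicate_succ]
    refine List.Forall₂.cons ?_ ih
    rcases x with _ | _ | _ <;> simp [triSym]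

theorem aux_first (n : ℕ) (F : List (Clause3 n)) (P : List OB) (hP : P.length ≤ n - 1) :
    ∃ i : ℕ, OccursAt (mawS n F) P i := by
  obtain ⟨X, hX⟩ := aux_lang_nonempty ((F.map fun C => clauseStr n C ++ [dolSym]).flatten) (by
    intro A hA
    simp only [List.mem_flatten, List.mem_map] at hA
    obtain ⟨l, ⟨C, _, rfl⟩, hA⟩ := hA
    rw [List.mem_append] at hA
    rcases hA with hA | hA
    · simp only [clauseStr, List.mem_map] at hA
      obtain ⟨i, _, rfl⟩ := hA
      split_ifs <;> simp [bitSym]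
    · simp only [List.mem_singleton] at hA
      subst hA
      simp [dolSym])
  obtain ⟨Y, hY⟩ := aux_lang_nonempty (List.replicate (n - 1) bitSym) (by
    intro A hA
    rw [List.eq_of_mem_replicate hA]
    simp [bitSym])
  have hQ := aux_tri (P ++ List.replicate (n - 1 - P.length) none)
  have hl : (P ++ List.replicate (n - 1 - P.length) (none : OB)).length = n - 1 := by
    simp; omega
  rw [hl] at hQ
  have hd : List.Forall₂ (fun (x : OB) A => x ∈ A) [none] [dolSym] :=
    List.Forall₂.cons (by simp [dolSym]) List.Forall₂.nil
  refine ⟨X.length, X ++ (P ++ List.replicate (n - 1 - P.length) none) ++ [none] ++ Y, ?_, ?_⟩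
  · exact List.rel_append (List.rel_append (List.rel_append hX hQ) hd) hY
  · simp [List.append_assoc]

/-- Every string over `{0,1,$}` of length at most `n-1` occurs in `S'`;
consequently, every (nonempty) word absent from `S'` has length at least `n`. -/
theorem short_strings_occur_and_absent_words_long (n : ℕ) (F : List (Clause3 n)) :
    (∀ P : List OB, P.length ≤ n - 1 → ∃ i : ℕ, OccursAt (mawS n F) P i) ∧
    (∀ P : List OB, P ≠ [] → (¬ ∃ i : ℕ, OccursAt (mawS n F) P i) → n ≤ P.length) := by
  refine ⟨aux_first n F, fun P _ h => ?_⟩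
  by_contra hn
  exact h (aux_first n F P (by omega))
end

section
/- Let F be a 3-CNF formula over n Boolean variables and S' the indeterminate string over {0,1,$} constructed from F for the absent-word reduction as described. Then every string over {0,1,$} of length at most n that contains at least one occurrence of the character $ occurs in S'. -/
theorem lang_replicate_aux (A : Set OB) (X : List OB) (k : ℕ) (hk : X.length = k)
    (h : ∀ x ∈ X, x ∈ A) : List.Forall₂ (fun x A => x ∈ A) X (List.replicate k A) := by
  subst hk
  induction X with
  | nil => simp
  | cons x X ih =>
    simp only [List.length_cons, List.replicate_succ]
    exact List.Forall₂.cons (h x (by simp)) (ih fun y hy => h y (by simp [hy]))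

theorem lang_exists_aux (S : List (Set OB)) (h : ∀ A ∈ S, A.Nonempty) :
    ∃ X, List.Forall₂ (fun x A => x ∈ A) X S := by
  induction S with
  | nil => exact ⟨[], by simp⟩
  | cons A S ih =>
    obtain ⟨X, hX⟩ := ih fun B hB => h B (by simp [hB])
    obtain ⟨x, hx⟩ := h A (by simp)
    exact ⟨x :: X, List.Forall₂.cons hx hX⟩

/-- Every string over `{0,1,$}` of length at most `n` that contains
at least one occurrence of the character `$` occurs in `S'`. -/
theorem dollar_strings_occur (n : ℕ) (F : List (Clause3 n)) :
    ∀ P : List OB, P.length ≤ n → (none : OB) ∈ P →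
      ∃ i : ℕ, OccursAt (mawS n F) P i := by
  intro P hP hmem
  obtain ⟨B', A', hrev, hB'⟩ := List.eq_append_cons_of_mem (List.mem_reverse.mpr hmem)
  obtain ⟨A, B, rfl, hB⟩ : ∃ A B, P = A ++ none :: B ∧ (none : OB) ∉ B := by
    refine ⟨A'.reverse, B'.reverse, ?_, by simpa using hB'⟩
    have := congrArg List.reverse hrev
    simpa using this
  simp only [List.length_append, List.length_cons] at hP
  obtain ⟨X0, hX0⟩ := lang_exists_aux
    ((F.map fun C => clauseStr n C ++ [dolSym]).flatten) (by
      intro S hS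
      simp only [List.mem_flatten, List.mem_map] at hS
      obtain ⟨l, ⟨C, _, rfl⟩, hS⟩ := hS
      rcases List.mem_append.mp hS with hS | hS
      · simp only [clauseStr, List.mem_map] at hS
        obtain ⟨i, _, rfl⟩ := hS
        split_ifs <;> simp [bitSym]
      · simp only [List.mem_singleton] at hS
        subst hS
        simp [dolSym])
  refine ⟨(X0 ++ List.replicate (n - 1 - A.length) none).length,
    X0 ++ (List.replicate (n - 1 - A.length) none ++ A) ++ [none] ++
      (B ++ List.replicate (n - 1 - B.length) (some false)), ?_, ?_⟩
  · refine List.rel_append (List.rel_append (List.rel_append hX0 ?_) ?_) ?_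
    · apply lang_replicate_aux
      · simp; omega
      · rintro (_ | _ | _) _ <;> simp [triSym]
    · simp [dolSym]
    · apply lang_replicate_aux
      · simp; omega
      · intro x hx
        rcases List.mem_append.mp hx with hx | hx
        · rcases x with _ | _ | _
          · exact absurd hx hB
          · simp [bitSym]
          · simp [bitSym]
        · rw [List.eq_of_mem_replicate hx]; simp [bitSym]
  · have : X0 ++ (List.replicate (n - 1 - A.length) none ++ A) ++ [none] ++
      (B ++ List.replicate (n - 1 - B.length) (some false)) =
      (X0 ++ List.replicate (n - 1 - A.length) none) ++ ((A ++ none :: B) ++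
        List.replicate (n - 1 - B.length) (some false)) := by simp
    rw [this, List.drop_left, List.take_left]
end

section
/- Let G = (V,E) be an undirected graph without self-loops on n ≥ 2 vertices, let S be the GD string constructed from G as described, and set k = 2(n(n−1)/2 − |E| + n) − 1. For Y ∈ L(S) and j ∈ [1..n], let W_Y[j] be the vertex v with Y[4|Ē| + 4(j−1) + 1] = c_v. Then Y is a k-anti-power if and only if W_Y is a Hamiltonian path of G, i.e., W_Y[1],…,W_Y[n] are pairwise distinct and {W_Y[j], W_Y[j+1]} ∈ E for every j ∈ [1..n−1]. -/
/-- The language of a GD string `S` (a list of nonempty sets of strings):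
all concatenations `w_1 ⋯ w_N` with `w_i ∈ S[i]`. -/
def GLang {α : Type*} (S : List (Set (List α))) : Set (List α) :=
  {T | ∃ ws : List (List α), List.Forall₂ (fun w A => w ∈ A) ws S ∧ ws.flatten = T}

/-- A classic string `T` is a `k`-anti-power: `|T| = k · ℓ` for some `ℓ ≥ 1` and
the `k` consecutive factors of length `ℓ` are pairwise distinct. -/
def IsAntipower {α : Type*} (k : ℕ) (T : List α) : Prop :=
  ∃ ℓ : ℕ, 1 ≤ ℓ ∧ T.length = k * ℓ ∧
    ∀ j₁ j₂ : ℕ, j₁ < k → j₂ < k → j₁ ≠ j₂ →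
      (T.drop (j₁ * ℓ)).take ℓ ≠ (T.drop (j₂ * ℓ)).take ℓ

/-- The four singleton symbols `c_u c_v c_v c_u` built from the non-edge
`p = {u, v}`. -/
def pairStr {n : ℕ} (p : Fin n × Fin n) : List (Set (List (Fin n))) :=
  [{[p.1]}, {[p.2]}, {[p.2]}, {[p.1]}]

/-- The symbol `A_3 = { c_v c_v c_v : v ∈ V }`. -/
def A3 (n : ℕ) : Set (List (Fin n)) := Set.range fun v : Fin n => [v, v, v]

/-- The symbol `A_4 = { c_v c_v c_v c_v : v ∈ V }`. -/
def A4 (n : ℕ) : Set (List (Fin n)) := Set.range fun v : Fin n => [v, v, v, v]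

/-- The GD string `S = S_1 ⋯ S_{|Ē|} · A_3 · A_4^{n-2} · A_3` built from an
enumeration `NE` of the non-edges of the graph. The alphabet is `Fin n`,
identifying the character `c_v` with the vertex `v`. -/
def gdS {n : ℕ} (NE : List (Fin n × Fin n)) : List (Set (List (Fin n))) :=
  (NE.map pairStr).flatten ++ [A3 n] ++ List.replicate (n - 2) (A4 n) ++ [A3 n]

theorem glang_append {α : Type*} {S S' : List (Set (List α))} {T : List α}
    (h : T ∈ GLang (S ++ S')) : ∃ T1 T2, T1 ∈ GLang S ∧ T2 ∈ GLang S' ∧ T = T1 ++ T2 := by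
  obtain ⟨ws, h1, rfl⟩ := h
  refine ⟨(ws.take S.length).flatten, (ws.drop S.length).flatten,
    ⟨_, List.forall₂_take_append _ _ _ h1, rfl⟩, ⟨_, List.forall₂_drop_append _ _ _ h1, rfl⟩, ?_⟩
  rw [← List.flatten_append, List.take_append_drop]

theorem glang_cons {α : Type*} {A : Set (List α)} {S' : List (Set (List α))} {T : List α}
    (h : T ∈ GLang (A :: S')) : ∃ T1 T2, T1 ∈ A ∧ T2 ∈ GLang S' ∧ T = T1 ++ T2 := by
  obtain ⟨ws, h1, rfl⟩ := h
  cases h1 with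
  | cons ha hb => exact ⟨_, _, ha, ⟨_, hb, rfl⟩, by simp⟩

theorem glang_nil {α : Type*} {T : List α}
    (h : T ∈ GLang ([] : List (Set (List α)))) : T = [] := by
  obtain ⟨ws, h1, rfl⟩ := h
  cases h1
  rfl

theorem glang_pairs {n : ℕ} (NE : List (Fin n × Fin n)) (T : List (Fin n))
    (h : T ∈ GLang (NE.map pairStr).flatten) :
    T = NE.flatMap (fun p => [p.1, p.2, p.2, p.1]) := by
  induction NE generalizing T with
  | nil => simpa using glang_nil h
  | cons p NE ih =>
    rw [List.map_cons, List.flatten_cons] at h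
    obtain ⟨T1, T2, h1, h2, rfl⟩ := glang_append h
    rw [ih T2 h2, List.flatMap_cons]
    congr 1
    obtain ⟨_, _, ha, ga, rfl⟩ := glang_cons h1
    obtain ⟨_, _, hb, gb, rfl⟩ := glang_cons ga
    obtain ⟨_, _, hc, gc, rfl⟩ := glang_cons gb
    obtain ⟨_, _, hd, gd, rfl⟩ := glang_cons gc
    rw [glang_nil gd]
    simp only [Set.mem_singleton_iff] at ha hb hc hd
    subst ha hb hc hd
    rfl

theorem glang_rep {n : ℕ} (m : ℕ) (T : List (Fin n))
    (h : T ∈ GLang (List.replicate m (A4 n))) :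
    ∃ L : List (Fin n), L.length = m ∧ T = L.flatMap (fun v => [v, v, v, v]) := by
  induction m generalizing T with
  | zero => exact ⟨[], rfl, by simpa using glang_nil h⟩
  | succ m ih =>
    rw [List.replicate_succ] at h
    obtain ⟨T1, T2, ⟨v, rfl⟩, h2, rfl⟩ := glang_cons h
    obtain ⟨L, hl, rfl⟩ := ih T2 h2
    exact ⟨v :: L, by simp [hl], by simp⟩

theorem glang_single {n : ℕ} (T : List (Fin n)) (h : T ∈ GLang [A3 n]) :
    ∃ v, T = [v, v, v] := by
  obtain ⟨T1, T2, ⟨v, rfl⟩, h2, rfl⟩ := glang_cons h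
  rw [glang_nil h2]
  exact ⟨v, rfl⟩

theorem flatMap4_len {α β : Type*} (f0 f1 f2 f3 : α → β) (L : List α) :
    (L.flatMap fun v => [f0 v, f1 v, f2 v, f3 v]).length = 4 * L.length := by
  induction L with
  | nil => simp
  | cons v L ih => rw [List.flatMap_cons, List.length_append, ih]; simp; omega

theorem flatMap4_get {α β : Type*} (f0 f1 f2 f3 : α → β) (L : List α) (d : β) (i : ℕ)
    (h : i < L.length) (R : List β) :
    let Z := (L.flatMap fun v => [f0 v, f1 v, f2 v, f3 v]) ++ R
    Z.getD (4 * i) d = f0 L[i] ∧ Z.getD (4 * i + 1) d = f1 L[i] ∧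
    Z.getD (4 * i + 2) d = f2 L[i] ∧ Z.getD (4 * i + 3) d = f3 L[i] := by
  induction L generalizing i with
  | nil => simp at h
  | cons v L ih =>
    cases i with
    | zero => simp
    | succ i =>
      have := ih i (by simpa using h)
      simpa [Nat.mul_add, Nat.add_right_comm _ 4] using this

theorem structY {n : ℕ} (hn : 2 ≤ n) (NE : List (Fin n × Fin n)) (Y : List (Fin n))
    (hY : Y ∈ GLang (gdS NE)) : ∃ (L : List (Fin n)) (a b : Fin n) (T : List (Fin n)),
      L.length = n ∧ a :: (T ++ [b]) = L.flatMap (fun v => [v, v, v, v]) ∧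
      Y = NE.flatMap (fun p => [p.1, p.2, p.2, p.1]) ++ T := by
  unfold gdS at hY
  obtain ⟨_, _, hY1, h4, rfl⟩ := glang_append hY
  obtain ⟨_, _, hY2, h3, rfl⟩ := glang_append hY1
  obtain ⟨_, _, hY3, h2, rfl⟩ := glang_append hY2
  rw [glang_pairs _ _ hY3]
  obtain ⟨a, rfl⟩ := glang_single _ h2
  obtain ⟨b, rfl⟩ := glang_single _ h4
  obtain ⟨L, hL, rfl⟩ := glang_rep _ _ h3
  refine ⟨a :: (L ++ [b]), a, b, [a, a, a] ++ (L.flatMap (fun v => [v, v, v, v]) ++ [b, b, b]),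
    ?_, ?_, ?_⟩
  · simp; omega
  · simp
  · simp

theorem antipower_iff {α : Type*} (k : ℕ) (hk : 1 ≤ k) (Y : List α) (d : α)
    (hY : Y.length = 2 * k) : IsAntipower k Y ↔ ∀ j₁ j₂ : ℕ, j₁ < k → j₂ < k →
      Y.getD (2 * j₁) d = Y.getD (2 * j₂) d → Y.getD (2 * j₁ + 1) d = Y.getD (2 * j₂ + 1) d →
      j₁ = j₂ := by
  have key : ∀ j, j < k → (Y.drop (j * 2)).take 2 = [Y.getD (2 * j) d, Y.getD (2 * j + 1) d] := by
    intro j hj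
    rw [List.drop_eq_getElem_cons (by omega), List.drop_eq_getElem_cons (by omega)]
    simp only [List.take_succ_cons, List.take_zero]
    rw [List.getD_eq_getElem _ _ (by omega), List.getD_eq_getElem _ _ (by omega)]
    simp [Nat.mul_comm]
  constructor
  · rintro ⟨l, hl, h1, h⟩ j₁ j₂ hj1 hj2 e1 e2
    have : l = 2 := by
      rw [hY, Nat.mul_comm] at h1
      exact (Nat.eq_of_mul_eq_mul_left hk h1).symm
    subst this
    by_contra hne
    apply h j₁ j₂ hj1 hj2 hne
    rw [key _ hj1, key _ hj2, e1, e2]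
  · intro h
    refine ⟨2, by omega, by omega, ?_⟩
    intro j₁ j₂ hj1 hj2 hne e
    rw [key _ hj1, key _ hj2] at e
    simp only [List.cons.injEq, and_true] at e
    exact hne (h _ _ hj1 hj2 e.1 e.2)

theorem card_NE {n : ℕ} (G : SimpleGraph (Fin n))
    [DecidableRel G.Adj] (NE : List (Fin n × Fin n))
    (hNE1 : (NE.map fun p => s(p.1, p.2)).Nodup)
    (hNE2 : ∀ u v : Fin n, s(u, v) ∈ NE.map (fun p => s(p.1, p.2)) ↔ Gᶜ.Adj u v) :
    n * (n - 1) / 2 - G.edgeFinset.card = NE.length := by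
  have h1 : Gᶜ.edgeFinset = (NE.map fun p => s(p.1, p.2)).toFinset := by
    ext e
    induction e with
    | h u v => rw [List.mem_toFinset, hNE2]; simp
  have h2 : Gᶜ.edgeFinset.card = NE.length := by
    rw [h1, List.toFinset_card_of_nodup hNE1, List.length_map]
  have h3 : G.edgeFinset ∪ Gᶜ.edgeFinset = (⊤ : SimpleGraph (Fin n)).edgeFinset := by
    ext e
    induction e with
    | h u v =>
      simp only [Finset.mem_union, SimpleGraph.mem_edgeFinset, SimpleGraph.mem_edgeSet,
        SimpleGraph.compl_adj, SimpleGraph.top_adj]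
      have := @SimpleGraph.Adj.ne _ G u v
      tauto
  have h4 : Disjoint G.edgeFinset Gᶜ.edgeFinset := by
    rw [Finset.disjoint_left]
    intro e
    induction e with
    | h u v =>
      simp only [SimpleGraph.mem_edgeFinset, SimpleGraph.mem_edgeSet, SimpleGraph.compl_adj]
      tauto
  have h5 := Finset.card_union_of_disjoint h4
  rw [h3, SimpleGraph.card_edgeFinset_top_eq_card_choose_two, Fintype.card_fin,
    Nat.choose_two_right] at h5
  omega

theorem core {n m N : ℕ} (G : SimpleGraph (Fin N)) (p q w g : ℕ → Fin N)
    (hinj : ∀ i j, i < m → j < m → s(p i, q i) = s(p j, q j) → i = j)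
    (hna : ∀ i, i < m → p i ≠ q i ∧ ¬ G.Adj (p i) (q i))
    (hcompl : ∀ u v, u ≠ v → ¬ G.Adj u v → ∃ i, i < m ∧ s(p i, q i) = s(u, v))
    (hP : ∀ i, i < m → g (4 * i) = p i ∧ g (4 * i + 1) = q i ∧
      g (4 * i + 2) = q i ∧ g (4 * i + 3) = p i)
    (hT1 : ∀ j, j < n → g (4 * m + 4 * j) = w j ∧ g (4 * m + 4 * j + 1) = w j)
    (hT2 : ∀ j, j + 1 < n → g (4 * m + 4 * j + 2) = w j ∧ g (4 * m + 4 * j + 3) = w (j + 1)) :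
    (∀ j₁ j₂ : ℕ, j₁ < 2 * (m + n) - 1 → j₂ < 2 * (m + n) - 1 →
      g (2 * j₁) = g (2 * j₂) → g (2 * j₁ + 1) = g (2 * j₂ + 1) → j₁ = j₂) ↔
    ((∀ i j, i < n → j < n → w i = w j → i = j) ∧ ∀ j, j + 1 < n → G.Adj (w j) (w (j + 1))) := by
  have eP0 : ∀ i, i < m → g (2 * (2 * i)) = p i ∧ g (2 * (2 * i) + 1) = q i := by
    intro i hi
    have := hP i hi
    rw [show 2 * (2 * i) = 4 * i by ring]
    tauto
  have eP1 : ∀ i, i < m → g (2 * (2 * i + 1)) = q i ∧ g (2 * (2 * i + 1) + 1) = p i := by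
    intro i hi
    have := hP i hi
    rw [show 2 * (2 * i + 1) = 4 * i + 2 by ring]
    tauto
  have eT0 : ∀ j, j < n → g (2 * (2 * m + 2 * j)) = w j ∧ g (2 * (2 * m + 2 * j) + 1) = w j := by
    intro i hi
    rw [show 2 * (2 * m + 2 * i) = 4 * m + 4 * i by ring]
    exact hT1 i hi
  have eT1 : ∀ j, j + 1 < n → g (2 * (2 * m + 2 * j + 1)) = w j ∧
      g (2 * (2 * m + 2 * j + 1) + 1) = w (j + 1) := by
    intro i hi
    rw [show 2 * (2 * m + 2 * i + 1) = 4 * m + 4 * i + 2 by ring]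
    exact hT2 i hi
  clear hP hT1 hT2
  constructor
  · intro h
    have hw : ∀ i j, i < n → j < n → w i = w j → i = j := by
      intro i j hi hj e
      have := h (2 * m + 2 * i) (2 * m + 2 * j) (by omega) (by omega)
        (by rw [(eT0 i hi).1, (eT0 j hj).1, e]) (by rw [(eT0 i hi).2, (eT0 j hj).2, e])
      omega
    refine ⟨hw, fun j hj => ?_⟩
    by_contra hn
    have hne : w j ≠ w (j + 1) := fun e => by
      have := hw _ _ (by omega) hj e
      omega
    obtain ⟨i, hi, e⟩ := hcompl _ _ hne hn
    rw [Sym2.eq_iff] at e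
    rcases e with ⟨e1, e2⟩ | ⟨e1, e2⟩
    · have := h (2 * i) (2 * m + 2 * j + 1) (by omega) (by omega)
        (by rw [(eP0 i hi).1, (eT1 j hj).1, e1]) (by rw [(eP0 i hi).2, (eT1 j hj).2, e2])
      omega
    · have := h (2 * i + 1) (2 * m + 2 * j + 1) (by omega) (by omega)
        (by rw [(eP1 i hi).1, (eT1 j hj).1, e2]) (by rw [(eP1 i hi).2, (eT1 j hj).2, e1])
      omega
  · rintro ⟨hw, hadj⟩
    have cls : ∀ j, j < 2 * (m + n) - 1 →
        (∃ i, i < m ∧ s(g (2 * j), g (2 * j + 1)) = s(p i, q i) ∧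
          ((j = 2 * i ∧ g (2 * j) = p i) ∨ (j = 2 * i + 1 ∧ g (2 * j) = q i))) ∨
        (∃ i, i < n ∧ j = 2 * m + 2 * i ∧ g (2 * j) = w i ∧ g (2 * j + 1) = w i) ∨
        (∃ i, i + 1 < n ∧ j = 2 * m + 2 * i + 1 ∧ g (2 * j) = w i ∧
          g (2 * j + 1) = w (i + 1)) := by
      intro j hj
      rcases Nat.even_or_odd' j with ⟨c, rfl | rfl⟩
      · by_cases hc : c < m
        · left
          refine ⟨c, hc, ?_, .inl ⟨rfl, (eP0 c hc).1⟩⟩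
          rw [(eP0 c hc).1, (eP0 c hc).2]
        · obtain ⟨i, rfl⟩ := Nat.exists_eq_add_of_le (not_lt.1 hc)
          right; left
          refine ⟨i, by omega, by ring, ?_⟩
          rw [Nat.mul_add 2 m i]
          exact eT0 i (by omega)
      · by_cases hc : c < m
        · left
          refine ⟨c, hc, ?_, .inr ⟨rfl, (eP1 c hc).1⟩⟩
          rw [(eP1 c hc).1, (eP1 c hc).2, Sym2.eq_swap]
        · obtain ⟨i, rfl⟩ := Nat.exists_eq_add_of_le (not_lt.1 hc)
          right; right
          refine ⟨i, by omega, by ring, ?_⟩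
          rw [Nat.mul_add 2 m i]
          exact eT1 i (by omega)
    have noPT : ∀ i, i < m → ∀ u v, (u = v ∨ G.Adj u v) → s(u, v) ≠ s(p i, q i) := by
      intro i hi u v h e
      have h1 := hna i hi
      have h2 := G.adj_comm (p i) (q i)
      rw [Sym2.eq_iff] at e
      grind
    intro j₁ j₂ h1 h2 e1 e2
    rcases cls j₁ h1 with ⟨a, ha, sa, ca⟩ | ⟨a, ha, ja, ga, ga'⟩ | ⟨a, ha, ja, ga, ga'⟩ <;>
    rcases cls j₂ h2 with ⟨b, hb, sb, cb⟩ | ⟨b, hb, jb, gb, gb'⟩ | ⟨b, hb, jb, gb, gb'⟩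
    · have hab : a = b := hinj a b ha hb (by rw [← sa, ← sb, e1, e2])
      subst hab
      have := (hna a ha).1
      grind
    · refine absurd sa (noPT a ha _ _ (.inl ?_))
      rw [e1, e2, gb, gb']
    · refine absurd sa (noPT a ha _ _ (.inr ?_))
      rw [e1, e2, gb, gb']
      exact hadj b hb
    · refine absurd sb (noPT b hb _ _ (.inl ?_))
      rw [← e1, ← e2, ga, ga']
    · have := hw a b ha hb (by rw [← ga, ← gb, e1])
      omega
    · have := hw b (b + 1) (by omega) hb (by rw [← gb, ← gb', ← e1, ← e2, ga, ga'])
      omega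
    · refine absurd sb (noPT b hb _ _ (.inr ?_))
      rw [← e1, ← e2, ga, ga']
      exact hadj a ha
    · have := hw a (a + 1) (by omega) ha (by rw [← ga, ← ga', e1, e2, gb, gb'])
      omega
    · have := hw a b (by omega) (by omega) (by rw [← ga, ← gb, e1])
      omega

/-- Let `G` be an undirected graph without self-loops on
`n ≥ 2` vertices, `NE` an enumeration (without repetitions) of its non-edges,
`S` the constructed GD string, and `k = 2(n(n-1)/2 - |E| + n) - 1`.
For `Y ∈ L(S)`, let `W j` (for `j = 0, …, n-1`, 0-based) be the vertex `v` with
`Y[4|Ē| + 4j] = c_v` (0-based character indexing). Then `Y` is a `k`-anti-power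
iff `W` is a Hamiltonian path of `G`, i.e., `W 0, …, W (n-1)` are pairwise
distinct and consecutive vertices are adjacent in `G`. -/
theorem gdS_antipower_iff_hamiltonian_path
    (n : ℕ) (hn : 2 ≤ n) (G : SimpleGraph (Fin n))
    [DecidableRel G.Adj] (NE : List (Fin n × Fin n))
    (hNE1 : (NE.map fun p => s(p.1, p.2)).Nodup)
    (hNE2 : ∀ u v : Fin n, s(u, v) ∈ NE.map (fun p => s(p.1, p.2)) ↔ Gᶜ.Adj u v)
    (k : ℕ) (hk : k = 2 * (n * (n - 1) / 2 - G.edgeFinset.card + n) - 1)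
    (Y : List (Fin n)) (hY : Y ∈ GLang (gdS NE))
    (W : Fin n → Fin n)
    (hW : ∀ j : Fin n, Y.getD (4 * NE.length + 4 * (j : ℕ)) ⟨0, by omega⟩ = W j) :
    IsAntipower k Y ↔
      (Function.Injective W ∧
        ∀ (j : ℕ) (h : j + 1 < n), G.Adj (W ⟨j, by omega⟩) (W ⟨j + 1, h⟩)) := by
  have hm := card_NE G NE hNE1 hNE2
  rw [hm] at hk
  obtain ⟨L, a, b, T, hL, hT, rfl⟩ := structY hn NE Y hY
  have hTl : T.length + 2 = 4 * n := by
    have := congrArg List.length hT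
    rw [flatMap4_len, hL] at this
    simpa using this
  have hPl := flatMap4_len (fun p : Fin n × Fin n => p.1) (fun p => p.2) (fun p => p.2)
    (fun p => p.1) NE
  generalize hd : (⟨0, by omega⟩ : Fin n) = d at hW
  have hg : ∀ i, i < T.length →
      (NE.flatMap (fun p => [p.1, p.2, p.2, p.1]) ++ T).getD (4 * NE.length + i) d =
      (L.flatMap (fun v => [v, v, v, v]) ++ []).getD (i + 1) d := by
    intro i hi
    rw [List.getD_append_right _ _ _ _ (by omega), hPl, Nat.add_sub_cancel_left, List.append_nil,
      ← hT, List.getD_cons_succ, List.getD_append _ _ _ _ hi]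
  have hLg := fun i h => flatMap4_get (fun v : Fin n => v) (fun v => v) (fun v => v)
    (fun v => v) L d i h []
  have hLw : ∀ j (h : j < n), L.getD j d = W ⟨j, h⟩ := by
    intro j h
    rw [← hW ⟨j, h⟩, hg _ (by simp only; omega), (hLg j (by omega)).2.1,
      List.getD_eq_getElem _ _ (by omega)]
  rw [antipower_iff k (by omega) _ d (by rw [List.length_append, hPl]; omega), hk,
    core (n := n) (m := NE.length) G (fun i => (NE.getD i (d, d)).1) (fun i => (NE.getD i (d, d)).2)
      (fun j => L.getD j d)
      (fun i => (NE.flatMap (fun p => [p.1, p.2, p.2, p.1]) ++ T).getD i d)]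
  · constructor
    · rintro ⟨h1, h2⟩
      refine ⟨fun x y e => ?_, fun j h => ?_⟩
      · apply Fin.ext
        apply h1 x y x.2 y.2
        simp only [hLw x x.2, hLw y y.2]
        exact e
      · have := h2 j h
        simp only [hLw j (by omega), hLw (j + 1) h] at this
        exact this
    · rintro ⟨h1, h2⟩
      refine ⟨fun i j hi hj e => ?_, fun j h => ?_⟩
      · simp only [hLw i hi, hLw j hj] at e
        simpa using h1 e
      · simp only [hLw j (by omega), hLw (j + 1) h]
        exact h2 j h
  · intro i j hi hj e
    simp only [List.getD_eq_getElem _ _ hi, List.getD_eq_getElem _ _ hj] at e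
    exact (List.Nodup.getElem_inj_iff hNE1 (hi := by simpa using hi) (hj := by simpa using hj)).1
      (by simpa using e)
  · intro i hi
    simp only [List.getD_eq_getElem _ _ hi]
    have := (hNE2 NE[i].1 NE[i].2).1 (List.mem_map.2 ⟨NE[i], List.getElem_mem hi, rfl⟩)
    rwa [SimpleGraph.compl_adj] at this
  · intro u v h1 h2
    have := (hNE2 u v).2 ((SimpleGraph.compl_adj _ _ _).2 ⟨h1, h2⟩)
    obtain ⟨p, hp, e⟩ := List.mem_map.1 this
    obtain ⟨i, hi, rfl⟩ := List.getElem_of_mem hp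
    refine ⟨i, hi, ?_⟩
    simp only [List.getD_eq_getElem _ _ hi]
    exact e
  · intro i hi
    simp only [List.getD_eq_getElem NE _ hi]
    exact flatMap4_get (fun p : Fin n × Fin n => p.1) (fun p => p.2) (fun p => p.2)
      (fun p => p.1) NE d i hi T
  · intro j hj
    have := hLg j (by omega)
    simp only [Nat.add_assoc (4 * NE.length), List.getD_eq_getElem L _ (hL ▸ hj)]
    rw [hg _ (by omega), hg _ (by omega)]
    exact ⟨this.2.1, this.2.2.1⟩
  · intro j hj
    have h1 := hLg j (by omega)
    have h2 := hLg (j + 1) (by omega)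
    simp only [Nat.add_assoc (4 * NE.length), List.getD_eq_getElem L _ (hL ▸ hj),
      List.getD_eq_getElem L _ (show j < L.length by omega)]
    rw [hg _ (by omega), hg _ (by omega)]
    exact ⟨h1.2.2.2, h2.1⟩
end

section
/- Let G = (V,E) be an undirected graph without self-loops on n ≥ 2 vertices, let S be the GD string constructed from G as described, and set k = 2(n(n−1)/2 − |E| + n) − 1. Then some string in L(S) is a k-anti-power if and only if G has a Hamiltonian path. -/
theorem mem_GLang_nil {α : Type*} (Y : List α) : Y ∈ GLang [] ↔ Y = [] := by
  simp [GLang, eq_comm]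

theorem mem_GLang_cons {α : Type*} (A : Set (List α)) (S : List (Set (List α))) (Y : List α) :
    Y ∈ GLang (A :: S) ↔ ∃ w ∈ A, ∃ Y' ∈ GLang S, Y = w ++ Y' := by
  constructor
  · rintro ⟨ws, h, rfl⟩
    cases h with
    | cons h1 h2 => exact ⟨_, h1, _, ⟨_, h2, rfl⟩, by simp⟩
  · rintro ⟨w, hw, _, ⟨ws, h, rfl⟩, rfl⟩
    exact ⟨w :: ws, List.Forall₂.cons hw h, by simp⟩

/-- Concatenate pairs. -/
def flat2 {α : Type*} : List (α × α) → List α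
  | [] => []
  | p :: l => p.1 :: p.2 :: flat2 l

theorem flat2_length {α : Type*} (l : List (α × α)) : (flat2 l).length = l.length * 2 := by
  induction l with
  | nil => rfl
  | cons a l ih => simp [flat2, ih]; omega

theorem flat2_block {α : Type*} (l : List (α × α)) (j : ℕ) (hj : j < l.length) :
    ((flat2 l).drop (j * 2)).take 2 = [l[j].1, l[j].2] := by
  induction l generalizing j with
  | nil => simp at hj
  | cons a l ih =>
    cases j with
    | zero => simp [flat2]
    | succ j =>
      have := ih j (by simpa using hj)
      simpa [flat2, Nat.succ_mul] using this

theorem antipower_flat2 {α : Type*} (l : List (α × α)) (hl : 0 < l.length) :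
    IsAntipower l.length (flat2 l) ↔ l.Nodup := by
  rw [List.nodup_iff_injective_getElem]
  constructor
  · rintro ⟨ℓ, h1, h2, h3⟩
    rw [flat2_length] at h2
    have := Nat.eq_of_mul_eq_mul_left hl h2
    subst this
    rintro ⟨i, hi⟩ ⟨j, hj⟩ h
    by_contra hne
    apply h3 i j hi hj (by simpa using hne)
    rw [flat2_block l i hi, flat2_block l j hj]
    simp only at h
    rw [h]
  · intro h
    refine ⟨2, by norm_num, flat2_length l, fun i j hi hj hne he => hne ?_⟩
    rw [flat2_block l i hi, flat2_block l j hj] at he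
    simp only [List.cons.injEq, and_true] at he
    have := @h ⟨i, hi⟩ ⟨j, hj⟩ (Prod.ext he.1 he.2)
    simpa using this

/-- Pairs of the tail. -/
def tl {α : Type*} : List α → List (α × α)
  | [] => []
  | [a] => [(a, a)]
  | a :: b :: l => (a, a) :: (a, b) :: tl (b :: l)

theorem tl_length {α : Type*} (a : α) (l : List α) : (tl (a :: l)).length = 2 * l.length + 1 := by
  induction l generalizing a with
  | nil => rfl
  | cons b l ih => simp [tl, ih]; omega

theorem tl_sub {α : Type*} (l : List α) : (l.map fun a => (a, a)).Sublist (tl l) := by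
  induction l with
  | nil => simp [tl]
  | cons a l ih =>
    cases l with
    | nil => simp [tl]
    | cons b l =>
      rw [List.map_cons, tl]
      exact (ih.cons _).cons_cons _

theorem tl_chain {α : Type*} (l : List α) : l.IsChain (fun a b => (a, b) ∈ tl l) := by
  induction l with
  | nil => simp
  | cons a l ih =>
    cases l with
    | nil => simp
    | cons b l =>
      rw [List.isChain_cons_cons]
      exact ⟨by simp [tl], ih.imp fun x y h => by simp [tl, h]⟩

theorem tl_mem {α : Type*} (l : List α) (p : α × α) (hp : p ∈ tl l) : p.1 ∈ l ∧ p.2 ∈ l := by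
  induction l with
  | nil => simp [tl] at hp
  | cons a l ih =>
    cases l with
    | nil => simp [tl] at hp; simp [hp]
    | cons b l =>
      rw [tl, List.mem_cons, List.mem_cons] at hp
      rcases hp with rfl | rfl | hp
      · simp
      · simp
      · have := ih hp
        exact ⟨List.mem_cons_of_mem _ this.1, List.mem_cons_of_mem _ this.2⟩

theorem tl_rel {α : Type*} (R : α → α → Prop) (l : List α) (hl : l.IsChain R)
    (p : α × α) (hp : p ∈ tl l) : p.1 = p.2 ∨ R p.1 p.2 := by
  induction l with
  | nil => simp [tl] at hp
  | cons a l ih =>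
    cases l with
    | nil => simp [tl] at hp; simp [hp]
    | cons b l =>
      rw [tl, List.mem_cons, List.mem_cons] at hp
      rw [List.isChain_cons_cons] at hl
      rcases hp with rfl | rfl | hp
      · simp
      · exact Or.inr hl.1
      · exact ih hl.2 hp

theorem tl_nodup {α : Type*} (l : List α) (hl : l.Nodup) : (tl l).Nodup := by
  induction l with
  | nil => simp [tl]
  | cons a l ih =>
    cases l with
    | nil => simp [tl]
    | cons b l =>
      rw [List.nodup_cons] at hl
      rw [tl, List.nodup_cons, List.nodup_cons, List.mem_cons]
      refine ⟨?_, fun h => hl.1 (tl_mem _ _ h).1, ih hl.2⟩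
      rintro (h | h)
      · simp at h
        exact hl.1 (by simp [h])
      · exact hl.1 (tl_mem _ _ h).1

theorem tl_nodup_iff {α : Type*} (l : List α) : (tl l).Nodup ↔ l.Nodup :=
  ⟨fun h => List.Nodup.of_map _ (h.sublist (tl_sub l)), tl_nodup l⟩

/-- Pairs of the non-edge part. -/
def np {α : Type*} : List (α × α) → List (α × α)
  | [] => []
  | p :: l => p :: (p.2, p.1) :: np l

theorem np_length {α : Type*} (l : List (α × α)) : (np l).length = 2 * l.length := by
  induction l with
  | nil => rfl
  | cons a l ih => simp [np, ih]; omega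

theorem np_mem {α : Type*} (l : List (α × α)) (u v : α) :
    (u, v) ∈ np l ↔ s(u, v) ∈ l.map (fun p => s(p.1, p.2)) := by
  induction l with
  | nil => simp [np]
  | cons p l ih =>
    obtain ⟨a, b⟩ := p
    rw [np, List.map_cons, List.mem_cons, List.mem_cons, List.mem_cons, ih, Sym2.eq_iff]
    simp only [Prod.mk.injEq]
    tauto

theorem np_nodup {α : Type*} (l : List (α × α)) (h : (l.map fun p => s(p.1, p.2)).Nodup)
    (h2 : ∀ u, (u, u) ∉ np l) : (np l).Nodup := by
  induction l with
  | nil => simp [np]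
  | cons p l ih =>
    obtain ⟨a, b⟩ := p
    rw [List.map_cons, List.nodup_cons] at h
    rw [np, List.nodup_cons, List.nodup_cons, List.mem_cons, np_mem, np_mem]
    refine ⟨?_, ?_, ih h.2 fun u hu => h2 u (by simp [np, hu])⟩
    · rintro (h' | h')
      · simp at h'
        obtain ⟨rfl, -⟩ := h'
        exact h2 a (by simp [np])
      · exact h.1 h'
    · intro h'
      rw [Sym2.eq_swap] at h'
      exact h.1 h'

theorem mem_tail {n : ℕ} (m : ℕ) (Y : List (Fin n)) :
    Y ∈ GLang (List.replicate m (A4 n) ++ [A3 n]) ↔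
      ∃ b l, l.length = m ∧ Y = b :: flat2 (tl (b :: l)) := by
  induction m generalizing Y with
  | zero =>
    rw [List.replicate_zero, List.nil_append, mem_GLang_cons]
    simp [mem_GLang_nil, A3, flat2, tl, eq_comm]
  | succ m ih =>
    rw [List.replicate_succ, List.cons_append, mem_GLang_cons]
    simp only [ih]
    constructor
    · rintro ⟨_, ⟨v, rfl⟩, _, ⟨b, l, hl, rfl⟩, rfl⟩
      exact ⟨v, b :: l, by simp [hl], by simp [tl, flat2]⟩
    · rintro ⟨v, l, hl, rfl⟩
      cases l with
      | nil => simp at hl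
      | cons b l => exact ⟨_, ⟨v, rfl⟩, _, ⟨b, l, by simpa using hl, rfl⟩, by simp [tl, flat2]⟩

theorem mem_tail' {n : ℕ} (m : ℕ) (Y : List (Fin n)) :
    Y ∈ GLang (A3 n :: (List.replicate m (A4 n) ++ [A3 n])) ↔
      ∃ l : List (Fin n), l.length = m + 2 ∧ Y = flat2 (tl l) := by
  rw [mem_GLang_cons]
  simp only [mem_tail]
  constructor
  · rintro ⟨_, ⟨v, rfl⟩, _, ⟨b, l, hl, rfl⟩, rfl⟩
    exact ⟨v :: b :: l, by simp [hl], by simp [tl, flat2]⟩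
  · rintro ⟨l, hl, rfl⟩
    match l, hl with
    | v :: b :: l, hl => exact ⟨_, ⟨v, rfl⟩, _, ⟨b, l, by simpa using hl, rfl⟩, by simp [tl, flat2]⟩

theorem mem_gdS {n : ℕ} (hn : 2 ≤ n) (NE : List (Fin n × Fin n)) (Y : List (Fin n)) :
    Y ∈ GLang (gdS NE) ↔ ∃ l : List (Fin n), l.length = n ∧ Y = flat2 (np NE ++ tl l) := by
  induction NE generalizing Y with
  | nil =>
    have := mem_tail' (n - 2) Y
    rw [Nat.sub_add_cancel hn] at this
    simpa [gdS, np] using this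
  | cons p NE ih =>
    have e : gdS (p :: NE) = {[p.1]} :: {[p.2]} :: {[p.2]} :: {[p.1]} :: gdS NE := by
      simp [gdS, pairStr]
    rw [e]
    simp only [mem_GLang_cons, ih, Set.mem_singleton_iff]
    constructor
    · rintro ⟨_, rfl, _, ⟨_, rfl, _, ⟨_, rfl, _, ⟨_, rfl, _, ⟨l, hl, rfl⟩, rfl⟩, rfl⟩, rfl⟩, rfl⟩
      exact ⟨l, hl, by simp [np, flat2]⟩
    · rintro ⟨l, hl, rfl⟩
      exact ⟨_, rfl, _, ⟨_, rfl, _, ⟨_, rfl, _, ⟨_, rfl, _, ⟨l, hl, rfl⟩, rfl⟩, rfl⟩, rfl⟩,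
        by simp [np, flat2]⟩

theorem NE_length {n : ℕ} (G : SimpleGraph (Fin n))
    [DecidableRel G.Adj] (NE : List (Fin n × Fin n))
    (hNE1 : (NE.map fun p => s(p.1, p.2)).Nodup)
    (hNE2 : ∀ u v : Fin n, s(u, v) ∈ NE.map (fun p => s(p.1, p.2)) ↔ Gᶜ.Adj u v) :
    NE.length = n * (n - 1) / 2 - G.edgeFinset.card := by
  classical
  have h1 : (NE.map fun p => s(p.1, p.2)).toFinset = Gᶜ.edgeFinset := by
    ext e
    induction e with
    | _ u v =>
      rw [List.mem_toFinset, hNE2, SimpleGraph.mem_edgeFinset, SimpleGraph.mem_edgeSet]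
  have h2 := List.toFinset_card_of_nodup hNE1
  rw [h1, List.length_map] at h2
  have h3 : Disjoint G.edgeFinset Gᶜ.edgeFinset := by
    rw [SimpleGraph.disjoint_edgeFinset]; exact disjoint_compl_right
  have h4 := Finset.card_union_of_disjoint h3
  have h5 : G.edgeFinset ∪ Gᶜ.edgeFinset = (⊤ : SimpleGraph (Fin n)).edgeFinset := by
    ext e
    induction e with
    | _ u v =>
      simp only [Finset.mem_union, SimpleGraph.mem_edgeFinset, SimpleGraph.mem_edgeSet,
        SimpleGraph.compl_adj, SimpleGraph.top_adj]
      by_cases h : G.Adj u v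
      · simp [h, h.ne]
      · simp [h]
  rw [h5, SimpleGraph.card_edgeFinset_top_eq_card_choose_two, Fintype.card_fin,
    Nat.choose_two_right] at h4
  omega

/-- Let `G` be an undirected graph without self-loops on
`n ≥ 2` vertices, `NE` an enumeration (without repetitions) of its non-edges,
`S` the constructed GD string, and `k = 2(n(n-1)/2 - |E| + n) - 1`.
Then some string in `L(S)` is a `k`-anti-power iff `G` has a Hamiltonian path
(a sequence of `n` pairwise distinct vertices with consecutive vertices adjacent). -/
theorem gdS_has_antipower_iff_hamiltonian
    (n : ℕ) (hn : 2 ≤ n) (G : SimpleGraph (Fin n))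
    [DecidableRel G.Adj] (NE : List (Fin n × Fin n))
    (hNE1 : (NE.map fun p => s(p.1, p.2)).Nodup)
    (hNE2 : ∀ u v : Fin n, s(u, v) ∈ NE.map (fun p => s(p.1, p.2)) ↔ Gᶜ.Adj u v)
    (k : ℕ) (hk : k = 2 * (n * (n - 1) / 2 - G.edgeFinset.card + n) - 1) :
    (∃ Y ∈ GLang (gdS NE), IsAntipower k Y) ↔
      ∃ W : Fin n → Fin n, Function.Injective W ∧
        ∀ (j : ℕ) (h : j + 1 < n), G.Adj (W ⟨j, by omega⟩) (W ⟨j + 1, h⟩) := by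
  have hm := NE_length G NE hNE1 hNE2
  have hnp : (np NE).Nodup := np_nodup NE hNE1 fun u hu => by
    rw [np_mem, hNE2] at hu
    exact hu.ne rfl
  have hlen : ∀ l : List (Fin n), l.length = n → (np NE ++ tl l).length = k := by
    intro l hl
    cases l with
    | nil => simp at hl; omega
    | cons a l =>
      rw [List.length_append, np_length, tl_length]
      simp at hl
      omega
  have key : ∀ l : List (Fin n), l.length = n →
      (IsAntipower k (flat2 (np NE ++ tl l)) ↔ l.Nodup ∧ l.IsChain G.Adj) := by
    intro l hl
    have h1 := antipower_flat2 (np NE ++ tl l) (by rw [hlen l hl]; omega)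
    rw [hlen l hl] at h1
    rw [h1, List.nodup_append, tl_nodup_iff]
    constructor
    · rintro ⟨-, h2, h3⟩
      refine ⟨h2, ?_⟩
      have hc := tl_chain l
      rw [List.isChain_iff_getElem] at hc ⊢
      intro i hi
      have h4 := hc i hi
      by_contra hna
      have hne : l[i] ≠ l[i + 1] := by
        intro h
        have := (List.Nodup.getElem_inj_iff h2).1 h
        omega
      have h5 : (l[i], l[i + 1]) ∈ np NE := by
        rw [np_mem, hNE2, SimpleGraph.compl_adj]
        exact ⟨hne, hna⟩
      exact h3 _ h5 _ h4 rfl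
    · rintro ⟨h2, h3⟩
      refine ⟨hnp, h2, ?_⟩
      rintro ⟨u, v⟩ hp _ hq rfl
      rw [np_mem, hNE2, SimpleGraph.compl_adj] at hp
      rcases tl_rel _ _ h3 _ hq with h | h
      · exact hp.1 h
      · exact hp.2 h
  constructor
  · rintro ⟨Y, hY, hA⟩
    obtain ⟨l, hl, rfl⟩ := (mem_gdS hn NE Y).1 hY
    obtain ⟨h1, h2⟩ := (key l hl).1 hA
    refine ⟨fun i => l[i.1]'(by omega), ?_, ?_⟩
    · intro i j h
      exact Fin.ext ((List.Nodup.getElem_inj_iff h1).1 h)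
    · intro j h
      exact List.isChain_iff_getElem.1 h2 j (by omega)
  · rintro ⟨W, hW, hG⟩
    refine ⟨_, (mem_gdS hn NE _).2 ⟨List.ofFn W, by simp, rfl⟩, (key _ (by simp)).2 ⟨?_, ?_⟩⟩
    · exact List.nodup_ofFn.2 hW
    · rw [List.isChain_iff_getElem]
      intro i hi
      simpa using hG i (by simpa using hi)
end
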